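/- Let 1 < p < q < ∞ and let s be a real number with 1/q < s < 1/p. There exists a constant c > 0 (depending only on p, q, s and φ₀) such that for every finite nonempty set A of nonnegative integers there exist a finite set E of Haar indices with HF(E) ⊆ A and a nonzero Schwartz function f : ℝ → ℂ with ‖P_E f‖_{F^s_{p,q}} ≥ c · (#A)^{s−1/q} · ‖f‖_{F^s_{p,q}}. -/

import Mathlib

open MeasureTheory Real FourierTransform
open scoped ENNReal

noncomputable section

def haarFn (j : ℕ) (μ : ℤ) : ℝ → ℂ := fun x =>
  (Set.Ico ((2:ℝ)^(-(j:ℤ)) * μ) ((2:ℝ)^(-(j:ℤ)) * (μ + 1/2))).indicator (fun _ => (1:ℂ)) x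
  - (Set.Ico ((2:ℝ)^(-(j:ℤ)) * (μ + 1/2)) ((2:ℝ)^(-(j:ℤ)) * (μ + 1))).indicator (fun _ => (1:ℂ)) x

def haarProj (E : Finset (ℕ × ℤ)) (f : ℝ → ℂ) : ℝ → ℂ := fun x =>
  ∑ e ∈ E, (2:ℂ)^e.1 * (∫ y : ℝ, f y * haarFn e.1 e.2 y) * haarFn e.1 e.2 x

def HFset (E : Finset (ℕ × ℤ)) : Finset ℕ := E.image Prod.fst

def conv (f g : ℝ → ℂ) : ℝ → ℂ := fun x => ∫ t : ℝ, f t * g (x - t)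

def LPop (φ₀ : ℝ → ℂ) (k : ℕ) (g : ℝ → ℂ) : ℝ → ℂ :=
  if k = 0 then conv g (𝓕⁻ φ₀)
  else conv g (fun x => (2:ℂ)^k * (𝓕⁻ (fun ξ => φ₀ ξ - φ₀ (2*ξ))) ((2:ℝ)^k * x))

def FNorm (φ₀ : ℝ → ℂ) (p q s : ℝ) (g : ℝ → ℂ) : ℝ≥0∞ :=
  (∫⁻ x : ℝ, (∑' k : ℕ, ENNReal.ofReal ((2:ℝ)^((k:ℝ)*s*q)) *
      (ENNReal.ofReal ‖LPop φ₀ k g x‖)^q)^(p/q) ∂volume)^(1/p)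

theorem enorm_rpow_le_sum_powerset {ι : Type*} [DecidableEq ι] (s : Finset ι) (y : ι → ℂ)
    {i : ι} (hi : i ∈ s) {p : ℝ} (hp : 1 ≤ p) :
    (2:ℝ≥0∞) ^ s.card * ‖y i‖ₑ ^ p ≤
      2 ^ p * ∑ t ∈ s.powerset, ‖∑ l ∈ t, y l‖ₑ ^ p := by
  have hne : i ∉ s.erase i := Finset.notMem_erase i s
  have hs : insert i (s.erase i) = s := Finset.insert_erase hi
  have hcard : s.card = (s.erase i).card + 1 := by
    rw [← Finset.card_insert_of_notMem hne, hs]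
  have h2 : (2:ℝ≥0∞) ^ p = 2 * 2 ^ (p - 1) := by
    nth_rewrite 2 [← ENNReal.rpow_one 2]
    rw [← ENNReal.rpow_add_of_nonneg _ _ zero_le_one (by linarith)]
    congr 1; ring
  have hsum : (2:ℝ≥0∞) ^ (s.erase i).card * ‖y i‖ₑ ^ p ≤
      2 ^ (p - 1) * ∑ t ∈ s.powerset, ‖∑ l ∈ t, y l‖ₑ ^ p := by
    conv_rhs => rw [← hs]
    rw [Finset.sum_powerset_insert hne, ← Finset.sum_add_distrib, Finset.mul_sum]
    rw [← Nat.cast_ofNat (R := ℝ≥0∞), ← Nat.cast_pow, ← Finset.card_powerset, ← nsmul_eq_mul,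
      ← Finset.sum_const]
    refine Finset.sum_le_sum fun t ht => ?_
    have hit : i ∉ t := fun h => hne (Finset.mem_powerset.1 ht h)
    rw [Finset.sum_insert hit]
    refine le_trans (ENNReal.rpow_le_rpow ?_ (by linarith))
      (ENNReal.rpow_add_le_mul_rpow_add_rpow _ _ hp)
    calc ‖y i‖ₑ = ‖(y i + ∑ l ∈ t, y l) - ∑ l ∈ t, y l‖ₑ := by congr 1; ring
      _ ≤ ‖y i + ∑ l ∈ t, y l‖ₑ + ‖∑ l ∈ t, y l‖ₑ := enorm_sub_le
      _ = _ := add_comm _ _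
  rw [hcard, pow_succ', h2, mul_assoc, mul_assoc]
  gcongr

theorem enorm_rpow_le_sum_powerset_powerset {ι κ : Type*} [DecidableEq ι] [DecidableEq κ]
    (s : Finset ι) (t : Finset κ) (y : ι → κ → ℂ) {i : ι} (hi : i ∈ s) {j : κ} (hj : j ∈ t)
    {p : ℝ} (hp : 1 ≤ p) :
    (2:ℝ≥0∞) ^ (s.card + t.card) * ‖y i j‖ₑ ^ p ≤
      2 ^ (2 * p) * ∑ S ∈ s.powerset, ∑ T ∈ t.powerset, ‖∑ l ∈ S, ∑ m ∈ T, y l m‖ₑ ^ p := by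
  have h2 : (2:ℝ≥0∞) ^ (2 * p) = 2 ^ p * 2 ^ p := by
    rw [two_mul, ENNReal.rpow_add_of_nonneg _ _ (by linarith) (by linarith)]
  calc (2:ℝ≥0∞) ^ (s.card + t.card) * ‖y i j‖ₑ ^ p
      = 2 ^ s.card * (2 ^ t.card * ‖y i j‖ₑ ^ p) := by rw [pow_add, mul_assoc]
    _ ≤ 2 ^ s.card * (2 ^ p * ∑ T ∈ t.powerset, ‖∑ m ∈ T, y i m‖ₑ ^ p) := by
        exact mul_le_mul_right (enorm_rpow_le_sum_powerset t (y i) hj hp) _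
    _ = 2 ^ p * ∑ T ∈ t.powerset, 2 ^ s.card * ‖∑ m ∈ T, y i m‖ₑ ^ p := by
        rw [Finset.mul_sum, Finset.mul_sum, Finset.mul_sum]
        exact Finset.sum_congr rfl fun _ _ => by ring
    _ ≤ 2 ^ p * ∑ T ∈ t.powerset, 2 ^ p * ∑ S ∈ s.powerset, ‖∑ l ∈ S, ∑ m ∈ T, y l m‖ₑ ^ p := by
        refine mul_le_mul_right (Finset.sum_le_sum fun T _ => ?_) _
        exact enorm_rpow_le_sum_powerset s (fun l => ∑ m ∈ T, y l m) hi hp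
    _ = _ := by rw [← Finset.mul_sum, ← mul_assoc, ← h2, Finset.sum_comm]

theorem card_mul_le_measure_biUnion {α ι : Type*} [MeasurableSpace α] (ν : Measure α)
    (B : ι → Set α) (hB : ∀ i, MeasurableSet (B i)) (b β : ℝ≥0∞) (A : Finset ι)
    (hb : ∀ i ∈ A, b ≤ ν (B i)) (hβ : ∀ i ∈ A, ∀ j ∈ A, i ≠ j → ν (B i ∩ B j) ≤ β) :
    A.card * b ≤ ν (⋃ i ∈ A, B i) + A.card ^ 2 * β := by
  classical
  induction A using Finset.induction_on with
  | empty => simp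
  | insert i A hi ih =>
    have ih' := ih (fun j hj => hb j (Finset.mem_insert_of_mem hj))
      (fun j hj l hl => hβ j (Finset.mem_insert_of_mem hj) l (Finset.mem_insert_of_mem hl))
    have hinter : ν (B i ∩ ⋃ j ∈ A, B j) ≤ A.card * β := by
      rw [Set.inter_iUnion₂, ← nsmul_eq_mul, ← Finset.sum_const]
      refine (measure_biUnion_finset_le A _).trans (Finset.sum_le_sum fun j hj => ?_)
      exact hβ i (Finset.mem_insert_self _ _) j (Finset.mem_insert_of_mem hj)
        (fun h => hi (h ▸ hj))
    have hU := measure_union_add_inter (μ := ν) (B i) (t := ⋃ j ∈ A, B j)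
      (Finset.measurableSet_biUnion A fun j _ => hB j)
    rw [Finset.card_insert_of_notMem hi, Finset.set_biUnion_insert]
    push_cast
    calc ((A.card : ℝ≥0∞) + 1) * b = b + A.card * b := by ring
      _ ≤ ν (B i) + (ν (⋃ i ∈ A, B i) + A.card ^ 2 * β) :=
          add_le_add (hb i (Finset.mem_insert_self _ _)) ih'
      _ = ν (B i ∪ ⋃ j ∈ A, B j) + ν (B i ∩ ⋃ j ∈ A, B j) + A.card ^ 2 * β := by
          rw [hU]; ring
      _ ≤ ν (B i ∪ ⋃ j ∈ A, B j) + A.card * β + A.card ^ 2 * β := by gcongr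
      _ ≤ ν (B i ∪ ⋃ j ∈ A, B j) + A.card * β + A.card ^ 2 * β + (A.card * β + β) :=
          le_self_add
      _ = _ := by ring

/-- The points whose `2 ^ j`-dilate lies in `μ + r * [w, w + ε)`. -/
def jumpCell (r w ε : ℝ) (j : ℕ) (μ : ℤ) : Set ℝ :=
  (fun x : ℝ => (2:ℝ) ^ j * x - μ) ⁻¹' Set.Ico (r * w) (r * (w + ε))

/-- The union of the cells attached to the dyadic points `2⁻ʲ μ` of `[0, 1)`. -/
def jumpSet (r w ε : ℝ) (j : ℕ) : Set ℝ :=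
  ⋃ μ ∈ Finset.Ico (0:ℤ) (2 ^ j), jumpCell r w ε j μ

theorem jumpCell_eq (r w ε : ℝ) (j : ℕ) (μ : ℤ) :
    jumpCell r w ε j μ = Set.Ico ((μ + r * w) / 2 ^ j) ((μ + r * (w + ε)) / 2 ^ j) := by
  have h : (0:ℝ) < 2 ^ j := by positivity
  ext x
  simp only [jumpCell, Set.mem_preimage, Set.mem_Ico, div_le_iff₀ h, lt_div_iff₀ h]
  constructor <;> rintro ⟨h1, h2⟩ <;> constructor <;> linarith

theorem measurableSet_jumpCell (r w ε : ℝ) (j : ℕ) (μ : ℤ) :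
    MeasurableSet (jumpCell r w ε j μ) := by
  rw [jumpCell_eq]; exact measurableSet_Ico

theorem measurableSet_jumpSet (r w ε : ℝ) (j : ℕ) : MeasurableSet (jumpSet r w ε j) :=
  Finset.measurableSet_biUnion _ fun _ _ => measurableSet_jumpCell _ _ _ _ _

theorem volume_jumpCell (r w ε : ℝ) (j : ℕ) (μ : ℤ) :
    volume (jumpCell r w ε j μ) = ENNReal.ofReal (r * ε / 2 ^ j) := by
  rw [jumpCell_eq, Real.volume_Ico]
  congr 1; ring

theorem cast_toNat_two_pow (j : ℕ) : (((2:ℤ) ^ j).toNat : ℝ) = 2 ^ j := by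
  have h : ((2:ℤ) ^ j).toNat = 2 ^ j := by
    rw [show ((2:ℤ) ^ j) = ((2 ^ j : ℕ) : ℤ) by push_cast; rfl, Int.toNat_natCast]
  rw [h]; push_cast; rfl

theorem volume_jumpSet {r w ε : ℝ} (hrε : r * ε ≤ 1) (j : ℕ) :
    volume (jumpSet r w ε j) = ENNReal.ofReal (r * ε) := by
  rw [jumpSet, measure_biUnion_finset]
  · simp only [volume_jumpCell, Finset.sum_const, Int.card_Ico, sub_zero]
    rw [nsmul_eq_mul, ← ENNReal.ofReal_natCast, ← ENNReal.ofReal_mul (by positivity)]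
    congr 1
    rw [cast_toNat_two_pow]; field_simp
  · intro μ _ ν _ hne
    rw [Function.onFun, Set.disjoint_left]
    rintro x ⟨h1, h2⟩ ⟨h3, h4⟩
    apply hne
    have h5 : ((μ - ν : ℤ) : ℝ) < 1 := by push_cast; nlinarith
    have h6 : ((ν - μ : ℤ) : ℝ) < 1 := by push_cast; nlinarith
    have h7 : μ - ν < 1 := by exact_mod_cast h5
    have h8 : ν - μ < 1 := by exact_mod_cast h6
    omega
  · exact fun _ _ => measurableSet_jumpCell _ _ _ _ _

theorem volume_jumpSet_inter_le_of_lt {r w ε : ℝ} (hr : 0 < r) (hε : 0 < ε) (hw : 2 * ε < |w|)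
    {i j : ℕ} (hij : i < j) :
    volume (jumpSet r w ε i ∩ jumpSet r w ε j) ≤
      ENNReal.ofReal (r ^ 2 * ε * (6 * |w|)) := by
  obtain ⟨d, rfl⟩ := Nat.exists_eq_add_of_lt hij
  set D : ℝ := 2 ^ (d + 1) with hD
  have hD2 : 2 ≤ D := by
    rw [hD, pow_succ]; nlinarith [one_le_pow₀ (M₀ := ℝ) (a := 2) (n := d) (by norm_num)]
  have hji : (2:ℝ) ^ (i + d + 1) = D * 2 ^ i := by rw [hD]; ring
  have hkey : ∀ x : ℝ, ∀ μ ν : ℤ, x ∈ jumpCell r w ε i μ → x ∈ jumpCell r w ε (i + d + 1) ν →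
      (ν : ℝ) - D * μ ∈ Set.Icc (r * (D * w - w - ε)) (r * (D * w + D * ε - w)) := by
    rintro x μ ν ⟨h1, h2⟩ ⟨h3, h4⟩
    rw [hji] at h3 h4
    have h1' := mul_le_mul_of_nonneg_left h1 (by linarith : 0 ≤ D)
    have h2' := mul_le_mul_of_nonneg_left h2.le (by linarith : 0 ≤ D)
    constructor <;> nlinarith
  by_cases hsmall : r * D * (3 * |w|) < 1
  · have hempty : jumpSet r w ε i ∩ jumpSet r w ε (i + d + 1) = ∅ := by
      rw [Set.eq_empty_iff_forall_notMem]
      rintro x ⟨hx1, hx2⟩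
      simp only [jumpSet, Set.mem_iUnion] at hx1 hx2
      obtain ⟨μ, -, hμ⟩ := hx1
      obtain ⟨ν, -, hν⟩ := hx2
      obtain ⟨h1, h2⟩ := hkey x μ ν hμ hν
      have hcast : (ν : ℝ) - D * μ = ((ν - 2 ^ (d + 1) * μ : ℤ) : ℝ) := by
        rw [hD]; push_cast; ring
      rw [hcast] at h1 h2
      rcases lt_or_ge 0 w with hw0 | hw0
      · rw [abs_of_pos hw0] at hw hsmall
        have ha : (0:ℝ) < ((ν - 2 ^ (d + 1) * μ : ℤ) : ℝ) := by
          refine lt_of_lt_of_le (mul_pos hr ?_) h1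
          nlinarith
        have hb : ((ν - 2 ^ (d + 1) * μ : ℤ) : ℝ) < 1 := by
          refine lt_of_le_of_lt h2 (lt_of_le_of_lt ?_ hsmall)
          rw [mul_assoc]
          refine mul_le_mul_of_nonneg_left ?_ hr.le
          nlinarith
        have ha' : 0 < ν - 2 ^ (d + 1) * μ := by exact_mod_cast ha
        have hb' : ν - 2 ^ (d + 1) * μ < 1 := by exact_mod_cast hb
        omega
      · rw [abs_of_nonpos hw0] at hw hsmall
        have ha : ((ν - 2 ^ (d + 1) * μ : ℤ) : ℝ) < 0 := by
          refine lt_of_le_of_lt h2 (mul_neg_of_pos_of_neg hr ?_)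
          nlinarith
        have hb : (-1:ℝ) < ((ν - 2 ^ (d + 1) * μ : ℤ) : ℝ) := by
          refine lt_of_lt_of_le (lt_of_lt_of_le (neg_lt_neg hsmall) ?_) h1
          rw [mul_assoc, ← mul_neg]
          refine mul_le_mul_of_nonneg_left ?_ hr.le
          nlinarith
        have ha' : ν - 2 ^ (d + 1) * μ < 0 := by exact_mod_cast ha
        have hb' : -1 < ν - 2 ^ (d + 1) * μ := by exact_mod_cast hb
        omega
    rw [hempty]; simp
  · push Not at hsmall
    let F : ℤ → Finset ℤ := fun μ => Finset.Icc ⌈D * μ + r * (D * w - w - ε)⌉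
      ⌊D * μ + r * (D * w + D * ε - w)⌋
    have hsub : jumpSet r w ε i ∩ jumpSet r w ε (i + d + 1) ⊆
        ⋃ μ ∈ Finset.Ico (0:ℤ) (2 ^ i), ⋃ ν ∈ F μ, jumpCell r w ε (i + d + 1) ν := by
      rintro x ⟨hx1, hx2⟩
      simp only [jumpSet, Set.mem_iUnion] at hx1 hx2 ⊢
      obtain ⟨μ, hμm, hμ⟩ := hx1
      obtain ⟨ν, -, hν⟩ := hx2
      obtain ⟨h1, h2⟩ := hkey x μ ν hμ hν
      refine ⟨μ, hμm, ν, ?_, hν⟩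
      simp only [F, Finset.mem_Icc, Int.ceil_le, Int.le_floor]
      constructor <;> linarith
    have hcard : ∀ μ, ((F μ).card : ℝ) ≤ r * D * (6 * |w|) := by
      intro μ
      have h0 : 0 ≤ r * D * (6 * |w|) := by positivity
      simp only [F, Int.card_Icc]
      rcases le_or_gt (⌊D * μ + r * (D * w + D * ε - w)⌋ + 1 -
        ⌈D * μ + r * (D * w - w - ε)⌉) 0 with hle | hlt
      · rw [Int.toNat_of_nonpos hle]; simpa using h0
      · have : (((⌊D * μ + r * (D * w + D * ε - w)⌋ + 1 -
            ⌈D * μ + r * (D * w - w - ε)⌉).toNat : ℤ) : ℝ) =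
            ((⌊D * μ + r * (D * w + D * ε - w)⌋ + 1 -
            ⌈D * μ + r * (D * w - w - ε)⌉ : ℤ) : ℝ) := by rw [Int.toNat_of_nonneg hlt.le]
        rw [Int.cast_natCast] at this
        rw [this]
        push_cast
        have hf := Int.floor_le (D * μ + r * (D * w + D * ε - w))
        have hc := Int.le_ceil (D * μ + r * (D * w - w - ε))
        have hrD : 0 ≤ r * D := by positivity
        nlinarith [mul_nonneg hr.le (sub_nonneg.2 hD2), mul_nonneg hrD (sub_nonneg.2 hw.le),
          mul_nonneg (mul_nonneg hr.le (sub_nonneg.2 hD2)) hε.le]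
    calc volume (jumpSet r w ε i ∩ jumpSet r w ε (i + d + 1))
        ≤ ∑ μ ∈ Finset.Ico (0:ℤ) (2 ^ i), ∑ ν ∈ F μ, volume (jumpCell r w ε (i + d + 1) ν) :=
          (measure_mono hsub).trans ((measure_biUnion_finset_le _ _).trans
            (Finset.sum_le_sum fun _ _ => measure_biUnion_finset_le _ _))
      _ ≤ ∑ μ ∈ Finset.Ico (0:ℤ) (2 ^ i), ENNReal.ofReal (r * D * (6 * |w|) *
            (r * ε / 2 ^ (i + d + 1))) := by
          refine Finset.sum_le_sum fun μ _ => ?_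
          simp only [volume_jumpCell, Finset.sum_const]
          rw [nsmul_eq_mul, ← ENNReal.ofReal_natCast, ← ENNReal.ofReal_mul (by positivity)]
          exact ENNReal.ofReal_le_ofReal
            (mul_le_mul_of_nonneg_right (hcard μ) (by positivity))
      _ = ENNReal.ofReal (r ^ 2 * ε * (6 * |w|)) := by
          simp only [Finset.sum_const, Int.card_Ico, sub_zero]
          rw [nsmul_eq_mul, ← ENNReal.ofReal_natCast, ← ENNReal.ofReal_mul (by positivity)]
          congr 1
          rw [cast_toNat_two_pow, hji]
          have : D ≠ 0 := by linarith
          field_simp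

theorem volume_jumpSet_inter_le {r w ε : ℝ} (hr : 0 < r) (hε : 0 < ε) (hw : 2 * ε < |w|)
    {i j : ℕ} (hij : i ≠ j) :
    volume (jumpSet r w ε i ∩ jumpSet r w ε j) ≤
      ENNReal.ofReal (r ^ 2 * ε * (6 * |w|)) := by
  rcases lt_or_gt_of_ne hij with h | h
  · exact volume_jumpSet_inter_le_of_lt hr hε hw h
  · rw [Set.inter_comm]; exact volume_jumpSet_inter_le_of_lt hr hε hw h

theorem le_volume_biUnion_jumpSet {r w ε : ℝ} (hr : 0 < r) (hε : 0 < ε) (hw : 2 * ε < |w|)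
    (hrε : r * ε ≤ 1) (A : Finset ℕ) (hA : A.card * r * (12 * |w|) ≤ 1) :
    ENNReal.ofReal (A.card * (r * ε) / 2) ≤ volume (⋃ j ∈ A, jumpSet r w ε j) := by
  have h := card_mul_le_measure_biUnion volume (jumpSet r w ε)
    (measurableSet_jumpSet r w ε) (ENNReal.ofReal (r * ε))
    (ENNReal.ofReal (r ^ 2 * ε * (6 * |w|))) A
    (fun i _ => (volume_jumpSet hrε i).ge)
    (fun i _ j _ hij => volume_jumpSet_inter_le hr hε hw hij)
  have h1 : (A.card : ℝ≥0∞) * ENNReal.ofReal (r * ε) = ENNReal.ofReal (A.card * (r * ε)) := by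
    rw [← ENNReal.ofReal_natCast, ← ENNReal.ofReal_mul (by positivity)]
  have h2 : (A.card : ℝ≥0∞) ^ 2 * ENNReal.ofReal (r ^ 2 * ε * (6 * |w|)) =
      ENNReal.ofReal (A.card ^ 2 * (r ^ 2 * ε * (6 * |w|))) := by
    rw [← ENNReal.ofReal_natCast, ← ENNReal.ofReal_pow (by positivity),
      ← ENNReal.ofReal_mul (by positivity)]
  rw [h1, h2] at h
  have h3 : (A.card : ℝ) ^ 2 * (r ^ 2 * ε * (6 * |w|)) ≤ A.card * (r * ε) / 2 := by
    have : 0 ≤ (A.card : ℝ) * (r * ε) := by positivity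
    nlinarith
  have h4 : ENNReal.ofReal (A.card * (r * ε)) =
      ENNReal.ofReal (A.card * (r * ε) / 2) + ENNReal.ofReal (A.card * (r * ε) / 2) := by
    rw [← ENNReal.ofReal_add (by positivity) (by positivity)]; congr 1; ring
  rw [h4] at h
  refine (ENNReal.add_le_add_iff_right
    (ENNReal.ofReal_ne_top (r := A.card * (r * ε) / 2))).1 (h.trans ?_)
  gcongr

theorem conv_fourierInv_fourierInv (a b : SchwartzMap ℝ ℂ) (x : ℝ) :
    conv (𝓕⁻ a : SchwartzMap ℝ ℂ) (𝓕⁻ b : SchwartzMap ℝ ℂ) x =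
      𝓕⁻ (fun ξ => a ξ * b ξ) x := by
  have h := SchwartzMap.convolution_apply (ContinuousLinearMap.mul ℂ ℂ) (𝓕⁻ a) (𝓕⁻ b) x
  have h2 : SchwartzMap.convolution (ContinuousLinearMap.mul ℂ ℂ) (𝓕⁻ a) (𝓕⁻ b) =
      𝓕⁻ (SchwartzMap.pairing (ContinuousLinearMap.mul ℂ ℂ) a b) := by
    rw [← FourierPair.fourierInv_fourier_eq (E := SchwartzMap ℝ ℂ) (F := SchwartzMap ℝ ℂ)
      (SchwartzMap.convolution (ContinuousLinearMap.mul ℂ ℂ) (𝓕⁻ a) (𝓕⁻ b)),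
      SchwartzMap.fourier_convolution, FourierTransform.fourier_fourierInv_eq,
      FourierTransform.fourier_fourierInv_eq]
  rw [h2, SchwartzMap.fourierInv_coe] at h
  have h3 : (fun ξ => a ξ * b ξ) =
      ((SchwartzMap.pairing (ContinuousLinearMap.mul ℂ ℂ) a b : SchwartzMap ℝ ℂ) : ℝ → ℂ) := by
    ext ξ; simp
  rw [h3, h]
  simp [conv, convolution]

theorem fourierInv_comp_div (g : ℝ → ℂ) {c : ℝ} (hc : 0 < c) (x : ℝ) :
    𝓕⁻ (fun ξ => g (ξ / c)) x = c * 𝓕⁻ g (c * x) := by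
  rw [Real.fourierInv_eq', Real.fourierInv_eq']
  have h := Measure.integral_comp_div
    (fun v : ℝ => Complex.exp (((2 * π * inner ℝ v (c * x) : ℝ) : ℂ) * Complex.I) • g v) c
  rw [abs_of_pos hc, Complex.real_smul] at h
  rw [← h]
  refine integral_congr_ae (Filter.Eventually.of_forall fun ξ => ?_)
  have hc' : (c : ℂ) ≠ 0 := by exact_mod_cast hc.ne'
  simp only [RCLike.inner_apply, conj_trivial]
  congr 3
  field_simp

theorem exists_symbol {φ₀ : ℝ → ℂ} (hφsmooth : ContDiff ℝ (⊤ : ℕ∞) φ₀)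
    (hφcpt : HasCompactSupport φ₀) (k : ℕ) :
    ∃ M : SchwartzMap ℝ ℂ, (∀ g, LPop φ₀ k g = conv g (𝓕⁻ M : SchwartzMap ℝ ℂ)) ∧
      ∀ ξ, M ξ = if k = 0 then φ₀ ξ else φ₀ (ξ / 2 ^ k) - φ₀ (2 * (ξ / 2 ^ k)) := by
  by_cases hk : k = 0
  · refine ⟨hφcpt.toSchwartzMap hφsmooth, fun g => ?_, fun ξ => ?_⟩
    · rw [SchwartzMap.fourierInv_coe]
      simp [LPop, hk]
      rfl
    · simp [hk]
  · have hc : (2:ℝ) ^ k ≠ 0 := by positivity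
    have hsm : ContDiff ℝ (⊤ : ℕ∞) fun ξ : ℝ => φ₀ (ξ / 2 ^ k) - φ₀ (2 * (ξ / 2 ^ k)) := by
      fun_prop
    have hcp : HasCompactSupport fun ξ : ℝ => φ₀ (ξ / 2 ^ k) - φ₀ (2 * (ξ / 2 ^ k)) := by
      have h1 : HasCompactSupport fun ξ : ℝ => φ₀ (ξ / 2 ^ k) := by
        have := hφcpt.comp_smul (c := ((2:ℝ) ^ k)⁻¹) (inv_ne_zero hc)
        simpa [div_eq_inv_mul] using this
      have h2 : HasCompactSupport fun ξ : ℝ => φ₀ (2 * (ξ / 2 ^ k)) := by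
        have := hφcpt.comp_smul (c := 2 * ((2:ℝ) ^ k)⁻¹) (by positivity)
        simpa [div_eq_inv_mul, mul_assoc] using this
      exact h1.sub h2
    refine ⟨hcp.toSchwartzMap hsm, fun g => ?_, fun ξ => by simp [hk]⟩
    rw [SchwartzMap.fourierInv_coe]
    simp only [LPop, hk, if_false]
    congr 1
    ext x
    have := fourierInv_comp_div (fun ξ => φ₀ ξ - φ₀ (2 * ξ)) (c := 2 ^ k) (by positivity) x
    push_cast at this
    exact this.symm

theorem conv_sum {ι : Type*} (s : Finset ι) (c : ι → ℂ) (g : ι → ℝ → ℂ) (K : ℝ → ℂ) (x : ℝ)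
    (h : ∀ i ∈ s, Integrable fun t => g i t * K (x - t)) :
    conv (fun t => ∑ i ∈ s, c i * g i t) K x = ∑ i ∈ s, c i * conv (g i) K x := by
  simp only [conv, Finset.sum_mul, mul_assoc]
  rw [integral_finsetSum _ fun i hi => (h i hi).const_mul (c i)]
  exact Finset.sum_congr rfl fun i _ => integral_const_mul _ _

theorem SchwartzMap.integrable_mul_comp_sub (K : SchwartzMap ℝ ℂ) {g : ℝ → ℂ}
    (hg : AEStronglyMeasurable g) {C : ℝ} (hC : ∀ t, ‖g t‖ ≤ C) (x : ℝ) :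
    Integrable fun t => g t * K (x - t) :=
  (K.integrable.comp_sub_left x).bdd_mul hg (Filter.Eventually.of_forall hC)

/-- The bump function with integral one that serves as frequency profile of the test functions. -/
def profileBump : ContDiffBump (0:ℝ) := ⟨1/400, 1/200, by norm_num, by norm_num⟩

theorem contDiff_shiftedProfile (a : ℝ) :
    ContDiff ℝ (⊤ : ℕ∞) fun ξ : ℝ => ((profileBump.normed volume (ξ - a) : ℝ) : ℂ) :=
  Complex.ofRealCLM.contDiff.comp (profileBump.contDiff_normed.comp (contDiff_id.sub contDiff_const))

theorem hasCompactSupport_shiftedProfile (a : ℝ) :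
    HasCompactSupport fun ξ : ℝ => ((profileBump.normed volume (ξ - a) : ℝ) : ℂ) := by
  have h := (profileBump.hasCompactSupport_normed (μ := volume)).comp_homeomorph
    (Homeomorph.subRight a)
  exact h.comp_left (g := fun t : ℝ => (t : ℂ)) Complex.ofReal_zero

/-- The profile translated to frequency `a`. -/
def shiftedProfile (a : ℝ) : SchwartzMap ℝ ℂ :=
  (hasCompactSupport_shiftedProfile a).toSchwartzMap (contDiff_shiftedProfile a)

theorem shiftedProfile_apply (a ξ : ℝ) :
    shiftedProfile a ξ = ((profileBump.normed volume (ξ - a) : ℝ) : ℂ) := rfl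

theorem shiftedProfile_eq_zero {a ξ : ℝ} (h : 1/200 ≤ |ξ - a|) : shiftedProfile a ξ = 0 := by
  have h1 : ξ - a ∉ Function.support (profileBump.normed volume) := by
    rw [profileBump.support_normed_eq]
    simpa [profileBump] using h
  rw [shiftedProfile_apply, Function.notMem_support.1 h1, Complex.ofReal_zero]

/-- The wave packet with frequency profile `shiftedProfile a`. -/
def wavePacket (a : ℝ) : SchwartzMap ℝ ℂ := 𝓕⁻ (shiftedProfile a)

theorem wavePacket_apply (a x : ℝ) :
    wavePacket a x = Complex.exp (2 * π * a * x * Complex.I) * wavePacket 0 x := by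
  simp only [wavePacket, SchwartzMap.fourierInv_coe]
  rw [Real.fourierInv_eq', Real.fourierInv_eq', ← integral_sub_right_eq_self _ (-a),
    ← integral_const_mul]
  refine integral_congr_ae (Filter.Eventually.of_forall fun ξ => ?_)
  simp only [shiftedProfile_apply, smul_eq_mul, sub_neg_eq_add, add_sub_cancel_right, sub_zero]
  rw [← mul_assoc, ← Complex.exp_add]
  congr 2
  simp
  ring

theorem norm_wavePacket (a x : ℝ) : ‖wavePacket a x‖ = ‖wavePacket 0 x‖ := by
  have : (2 * π * a * x * Complex.I : ℂ) = ((2 * π * a * x : ℝ) : ℂ) * Complex.I := by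
    push_cast; ring
  rw [wavePacket_apply, norm_mul, this, Complex.norm_exp_ofReal_mul_I, one_mul]

theorem norm_wavePacket_zero_sub_one_le {x : ℝ} (hx : |x| ≤ 1) :
    ‖wavePacket 0 x - 1‖ ≤ 1 / 10 := by
  have hintegral : ∫ ξ : ℝ, shiftedProfile 0 ξ = 1 := by
    simp only [shiftedProfile_apply, sub_zero]
    rw [integral_complex_ofReal, profileBump.integral_normed, Complex.ofReal_one]
  have hnorm : ∫ ξ : ℝ, ‖shiftedProfile 0 ξ‖ = 1 := by
    simp only [shiftedProfile_apply, sub_zero, Complex.norm_real]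
    rw [← profileBump.integral_normed (μ := volume)]
    exact integral_congr_ae (Filter.Eventually.of_forall fun ξ => by
      simp only [Real.norm_eq_abs]; exact abs_of_nonneg (profileBump.nonneg_normed _))
  have hI := (shiftedProfile 0).integrable (μ := volume)
  have hI2 : Integrable fun ξ : ℝ =>
      Complex.exp (((2 * π * inner ℝ ξ x : ℝ) : ℂ) * Complex.I) • shiftedProfile 0 ξ := by
    simp only [smul_eq_mul]
    refine hI.bdd_mul (c := 1) ?_ (Filter.Eventually.of_forall fun ξ => ?_)
    · exact (by fun_prop : Continuous fun ξ : ℝ =>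
        Complex.exp (((2 * π * inner ℝ ξ x : ℝ) : ℂ) * Complex.I)).aestronglyMeasurable
    · rw [Complex.norm_exp_ofReal_mul_I]
  simp only [wavePacket, SchwartzMap.fourierInv_coe]
  rw [Real.fourierInv_eq', ← hintegral, ← integral_sub hI2 hI]
  calc _ ≤ ∫ ξ : ℝ, 1 / 10 * ‖shiftedProfile 0 ξ‖ := by
        refine norm_integral_le_of_norm_le (hI.norm.const_mul _)
          (Filter.Eventually.of_forall fun ξ => ?_)
        rcases le_or_gt (1/200) |ξ - 0| with h | h
        · simp [shiftedProfile_eq_zero h]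
        · rw [smul_eq_mul, ← sub_one_mul, norm_mul]
          refine mul_le_mul_of_nonneg_right ?_ (norm_nonneg _)
          rw [mul_comm]
          refine (Real.norm_exp_I_mul_ofReal_sub_one_le).trans ?_
          rw [sub_zero] at h
          simp only [RCLike.inner_apply, conj_trivial, norm_mul, Real.norm_eq_abs]
          rw [abs_of_pos pi_pos, abs_two]
          have h1 : |x| * |ξ| ≤ 1 * (1/200) :=
            mul_le_mul hx h.le (abs_nonneg _) zero_le_one
          have h2 := Real.pi_lt_four
          have h3 := Real.pi_pos
          nlinarith
    _ = 1 / 10 := by rw [integral_const_mul, hnorm, mul_one]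

theorem LPop_wavePacket {φ₀ : ℝ → ℂ} (hφsmooth : ContDiff ℝ (⊤ : ℕ∞) φ₀)
    (hφcpt : HasCompactSupport φ₀) (hφone : ∀ ξ : ℝ, |ξ| ≤ 4/3 → φ₀ ξ = 1)
    (hφzero : ∀ ξ : ℝ, 3/2 ≤ |ξ| → φ₀ ξ = 0) (k j : ℕ) (x : ℝ) :
    LPop φ₀ k (wavePacket (2 ^ j)) x = if j = k then wavePacket (2 ^ k) x else 0 := by
  obtain ⟨M, hM, hMξ⟩ := exists_symbol hφsmooth hφcpt k
  rw [hM, wavePacket, conv_fourierInv_fourierInv]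
  have hmul : ∀ ξ, shiftedProfile (2 ^ j) ξ * M ξ =
      if j = k then shiftedProfile (2 ^ k) ξ else 0 := by
    intro ξ
    rcases le_or_gt (1/200) |ξ - 2 ^ j| with h | h
    · rw [shiftedProfile_eq_zero h, zero_mul]
      split_ifs with hjk
      · rw [← hjk, shiftedProfile_eq_zero h]
      · rfl
    · rw [abs_lt] at h
      have hj1 : (1:ℝ) ≤ 2 ^ j := one_le_pow₀ (by norm_num)
      have hξ0 : 0 < ξ := by linarith
      have hk1 : (1:ℝ) ≤ 2 ^ k := one_le_pow₀ (by norm_num)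
      have hk0 : (0:ℝ) < 2 ^ k := by positivity
      have hdiv : 0 < ξ / 2 ^ k := by positivity
      rw [hMξ]
      rcases lt_trichotomy j k with hjk | hjk | hjk
      · have hk : k ≠ 0 := by omega
        have hle : (2:ℝ) * 2 ^ j ≤ 2 ^ k := by
          rw [← pow_succ']; exact pow_le_pow_right₀ (by norm_num) hjk
        have hd : 2 * (ξ / 2 ^ k) ≤ 4/3 := by
          rw [← mul_div_assoc, div_le_iff₀ hk0]; linarith
        rw [if_neg hk, if_neg hjk.ne, hφone _ (by rw [abs_of_pos hdiv]; linarith),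
          hφone _ (by rw [abs_of_pos (by linarith)]; exact hd), sub_self, mul_zero]
      · subst hjk
        have hd : ξ / 2 ^ j ≤ 4/3 := by rw [div_le_iff₀ hk0]; linarith
        have hd2 : 3/2 ≤ 2 * (ξ / 2 ^ j) := by
          rw [← mul_div_assoc, le_div_iff₀ hk0]; linarith
        rw [if_pos rfl]
        split_ifs with hj
        · subst hj
          rw [pow_zero, div_one] at hd
          rw [hφone ξ (by rw [abs_of_pos hξ0]; exact hd), mul_one]
        · rw [hφone _ (by rw [abs_of_pos hdiv]; exact hd),
            hφzero _ (by rw [abs_of_pos (by linarith)]; exact hd2), sub_zero, mul_one]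
      · have hle : (2:ℝ) * 2 ^ k ≤ 2 ^ j := by
          rw [← pow_succ']; exact pow_le_pow_right₀ (by norm_num) hjk
        have hd : 3/2 ≤ ξ / 2 ^ k := by rw [le_div_iff₀ hk0]; linarith
        rw [if_neg hjk.ne']
        split_ifs with hk
        · subst hk
          rw [pow_zero, div_one] at hd
          rw [hφzero ξ (by rw [abs_of_pos hξ0]; exact hd), mul_zero]
        · rw [hφzero _ (by rw [abs_of_pos hdiv]; exact hd),
            hφzero _ (by rw [abs_of_pos (by linarith)]; linarith), sub_zero, mul_zero]
  simp only [hmul]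
  split_ifs
  · rw [wavePacket, SchwartzMap.fourierInv_coe]
  · simp [Real.fourierInv_eq']

/-- A sum of wave packets at the frequencies `2 ^ j`, `j ∈ S`, with amplitudes `2 ^ (-j s)`. -/
def packetSum (s : ℝ) (S : Finset ℕ) : SchwartzMap ℝ ℂ :=
  ∑ j ∈ S, (((2:ℝ) ^ (-((j:ℝ) * s)) : ℝ) : ℂ) • wavePacket (2 ^ j)

theorem packetSum_apply (s : ℝ) (S : Finset ℕ) (x : ℝ) :
    packetSum s S x = ∑ j ∈ S, (((2:ℝ) ^ (-((j:ℝ) * s)) : ℝ) : ℂ) * wavePacket (2 ^ j) x := by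
  simp [packetSum]

theorem LPop_packetSum {φ₀ : ℝ → ℂ} (hφsmooth : ContDiff ℝ (⊤ : ℕ∞) φ₀)
    (hφcpt : HasCompactSupport φ₀) (hφone : ∀ ξ : ℝ, |ξ| ≤ 4/3 → φ₀ ξ = 1)
    (hφzero : ∀ ξ : ℝ, 3/2 ≤ |ξ| → φ₀ ξ = 0) (s : ℝ) (S : Finset ℕ) (k : ℕ) (x : ℝ) :
    LPop φ₀ k (packetSum s S) x =
      if k ∈ S then (((2:ℝ) ^ (-((k:ℝ) * s)) : ℝ) : ℂ) * wavePacket (2 ^ k) x else 0 := by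
  have hfun : (packetSum s S : ℝ → ℂ) = fun t =>
      ∑ j ∈ S, (((2:ℝ) ^ (-((j:ℝ) * s)) : ℝ) : ℂ) * wavePacket (2 ^ j) t :=
    funext (packetSum_apply s S)
  obtain ⟨M, hM, -⟩ := exists_symbol hφsmooth hφcpt k
  rw [hM, hfun, conv_sum]
  · simp only [← hM, LPop_wavePacket hφsmooth hφcpt hφone hφzero, mul_ite, mul_zero]
    rw [Finset.sum_ite_eq']
  · intro j _
    exact SchwartzMap.integrable_mul_comp_sub _
      (wavePacket (2 ^ j)).continuous.aestronglyMeasurable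
      (SchwartzMap.norm_le_seminorm ℝ (wavePacket (2 ^ j))) x

theorem lintegral_wavePacket_rpow_lt_top {p : ℝ} (hp : 1 < p) :
    ∫⁻ x : ℝ, ‖wavePacket 0 x‖ₑ ^ p < ∞ := by
  have h := (wavePacket 0).memLp (ENNReal.ofReal p) (volume : Measure ℝ)
  have h2 := lintegral_rpow_enorm_lt_top_of_eLpNorm_lt_top (by simp; linarith)
    ENNReal.ofReal_ne_top h.2
  rwa [ENNReal.toReal_ofReal (by linarith)] at h2

theorem FNorm_packetSum {φ₀ : ℝ → ℂ} (hφsmooth : ContDiff ℝ (⊤ : ℕ∞) φ₀)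
    (hφcpt : HasCompactSupport φ₀) (hφone : ∀ ξ : ℝ, |ξ| ≤ 4/3 → φ₀ ξ = 1)
    (hφzero : ∀ ξ : ℝ, 3/2 ≤ |ξ| → φ₀ ξ = 0) {p q : ℝ} (hp : 1 < p) (hpq : p < q) (s : ℝ)
    (S : Finset ℕ) :
    FNorm φ₀ p q s (packetSum s S) =
      (S.card : ℝ≥0∞) ^ (1/q) * (∫⁻ x : ℝ, ‖wavePacket 0 x‖ₑ ^ p) ^ (1/p) := by
  have hp0 : 0 < p := by linarith
  have hq0 : 0 < q := by linarith
  have hpt : ∀ x : ℝ, (∑' k : ℕ, ENNReal.ofReal ((2:ℝ)^((k:ℝ)*s*q)) *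
      (ENNReal.ofReal ‖LPop φ₀ k (packetSum s S) x‖)^q)^(p/q) =
      (S.card : ℝ≥0∞) ^ (p/q) * ‖wavePacket 0 x‖ₑ ^ p := by
    intro x
    have hterm : ∀ k : ℕ, ENNReal.ofReal ((2:ℝ)^((k:ℝ)*s*q)) *
        (ENNReal.ofReal ‖LPop φ₀ k (packetSum s S) x‖)^q =
        if k ∈ S then ‖wavePacket 0 x‖ₑ ^ q else 0 := by
      intro k
      rw [LPop_packetSum hφsmooth hφcpt hφone hφzero]
      split_ifs
      · rw [norm_mul, norm_wavePacket, Complex.norm_real, Real.norm_eq_abs,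
          abs_of_pos (by positivity), ENNReal.ofReal_mul (by positivity),
          ENNReal.mul_rpow_of_nonneg _ _ hq0.le, ENNReal.ofReal_rpow_of_pos (by positivity),
          ← Real.rpow_mul (by norm_num), ← mul_assoc, ← ENNReal.ofReal_mul (by positivity),
          ← Real.rpow_add (by norm_num), ofReal_norm]
        rw [show (k:ℝ) * s * q + -(k * s) * q = 0 by ring]
        simp
      · simp [hq0]
    simp only [hterm]
    rw [tsum_eq_sum (s := S) (fun k hk => if_neg hk), Finset.sum_ite_mem, Finset.inter_self,
      Finset.sum_const, nsmul_eq_mul, ENNReal.mul_rpow_of_nonneg _ _ (by positivity),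
      ← ENNReal.rpow_mul, mul_div_cancel₀ _ hq0.ne']
  rw [FNorm]
  simp only [hpt]
  rw [lintegral_const_mul' _ _ (ENNReal.rpow_ne_top_of_nonneg (by positivity) (by simp)),
    ENNReal.mul_rpow_of_nonneg _ _ (by positivity), ← ENNReal.rpow_mul]
  congr 2
  field_simp

theorem integral_mul_haarFn {g : ℝ → ℂ} (hg : Continuous g) (j : ℕ) (μ : ℤ) :
    ∫ y : ℝ, g y * haarFn j μ y =
      (∫ y in (μ / 2 ^ j : ℝ)..((μ + 1/2) / 2 ^ j), g y) -
        ∫ y in ((μ + 1/2) / 2 ^ j : ℝ)..((μ + 1) / 2 ^ j), g y := by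
  have hpos : (0:ℝ) < 2 ^ j := by positivity
  have hind : ∀ a b : ℝ, a ≤ b →
      Integrable (fun y => g y * (Set.Ico a b).indicator (fun _ => (1:ℂ)) y) ∧
      ∫ y : ℝ, g y * (Set.Ico a b).indicator (fun _ => (1:ℂ)) y = ∫ y in a..b, g y := by
    intro a b hab
    have h : (fun y => g y * (Set.Ico a b).indicator (fun _ => (1:ℂ)) y) =
        (Set.Ico a b).indicator g := by
      ext y; by_cases hy : y ∈ Set.Ico a b <;> simp [hy]
    rw [h]
    refine ⟨?_, ?_⟩
    · rw [integrable_indicator_iff measurableSet_Ico]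
      exact (hg.integrableOn_Icc (a := a) (b := b)).mono_set Set.Ico_subset_Icc_self
    · rw [integral_indicator measurableSet_Ico, intervalIntegral.integral_of_le hab,
        integral_Ico_eq_integral_Ioc]
  have h1 := hind (μ / 2 ^ j) ((μ + 1/2) / 2 ^ j) (by gcongr; linarith)
  have h2 := hind ((μ + 1/2) / 2 ^ j) ((μ + 1) / 2 ^ j) (by gcongr; linarith)
  rw [← h1.2, ← h2.2, ← integral_sub h1.1 h2.1]
  refine integral_congr_ae (Filter.Eventually.of_forall fun y => ?_)
  simp only [haarFn, zpow_neg, zpow_natCast, mul_sub, inv_mul_eq_div]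

theorem measurable_haarFn (j : ℕ) (μ : ℤ) : Measurable (haarFn j μ) :=
  (measurable_const.indicator measurableSet_Ico).sub
    (measurable_const.indicator measurableSet_Ico)

theorem norm_haarFn_le (j : ℕ) (μ : ℤ) (x : ℝ) : ‖haarFn j μ x‖ ≤ 2 := by
  have h : ∀ a b : ℝ, ‖(Set.Ico a b).indicator (fun _ => (1:ℂ)) x‖ ≤ 1 := fun a b =>
    (norm_indicator_le_norm_self _ _).trans (by simp)
  calc ‖haarFn j μ x‖ ≤ 1 + 1 := (norm_sub_le _ _).trans (add_le_add (h _ _) (h _ _))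
    _ = 2 := by norm_num

theorem half_le_norm_haar_coeff (j : ℕ) {μ : ℤ} (h0 : 0 ≤ μ) (h1 : μ < 2 ^ j) :
    1/2 ≤ ‖(2:ℂ) ^ j * ∫ y : ℝ, wavePacket (2 ^ j) y * haarFn j μ y‖ := by
  have hpos : (0:ℝ) < 2 ^ j := by positivity
  have hμ0 : (0:ℝ) ≤ μ := by exact_mod_cast h0
  have hμ1 : (μ:ℝ) + 1 ≤ 2 ^ j := by exact_mod_cast h1
  set e : ℝ → ℂ := fun y => Complex.exp ((2 * π * 2 ^ j * Complex.I) * y) with he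
  have hec : Continuous e := by fun_prop
  have hwc : Continuous (wavePacket (2 ^ j)) := (wavePacket (2 ^ j)).continuous
  have hc : (2 * π * 2 ^ j * Complex.I : ℂ) ≠ 0 := by
    simp [Real.pi_ne_zero]
  have hdiff : ∀ y ∈ Set.Icc (0:ℝ) 1, ‖wavePacket (2 ^ j) y - e y‖ ≤ 1/10 := by
    intro y hy
    have hey : wavePacket (2 ^ j) y - e y = e y * (wavePacket 0 y - 1) := by
      rw [wavePacket_apply, he, mul_sub, mul_one]
      push_cast
      ring_nf
    have hn : ‖e y‖ = 1 := by
      simp only [he]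
      rw [show (2 * π * 2 ^ j * Complex.I * y : ℂ) = ((2 * π * 2 ^ j * y : ℝ) : ℂ) * Complex.I by
        push_cast; ring]
      exact Complex.norm_exp_ofReal_mul_I _
    rw [hey, norm_mul, hn, one_mul]
    exact norm_wavePacket_zero_sub_one_le (by rw [abs_le]; constructor <;> linarith [hy.1, hy.2])
  have hloc : ∀ a b : ℝ, 0 ≤ a → a ≤ b → b ≤ 1 →
      ‖(∫ y in a..b, wavePacket (2 ^ j) y) - ∫ y in a..b, e y‖ ≤ 1/10 * (b - a) := by
    intro a b ha hab hb
    rw [← intervalIntegral.integral_sub (hwc.intervalIntegrable _ _) (hec.intervalIntegrable _ _),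
      ← abs_of_nonneg (sub_nonneg.2 hab)]
    refine intervalIntegral.norm_integral_le_of_norm_le_const fun y hy => ?_
    rw [Set.uIoc_of_le hab] at hy
    exact hdiff y ⟨by linarith [hy.1], by linarith [hy.2]⟩
  have hea : Complex.exp ((2 * π * 2 ^ j * Complex.I) * ((μ / 2 ^ j : ℝ) : ℂ)) = 1 := by
    rw [Complex.exp_eq_one_iff]
    refine ⟨μ, ?_⟩
    push_cast; field_simp
  have heb : Complex.exp ((2 * π * 2 ^ j * Complex.I) * (((μ + 1) / 2 ^ j : ℝ) : ℂ)) = 1 := by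
    rw [Complex.exp_eq_one_iff]
    refine ⟨μ + 1, ?_⟩
    push_cast; field_simp
  have hem : Complex.exp ((2 * π * 2 ^ j * Complex.I) * (((μ + 1/2) / 2 ^ j : ℝ) : ℂ)) = -1 := by
    have : (2 * π * 2 ^ j * Complex.I) * (((μ + 1/2) / 2 ^ j : ℝ) : ℂ) =
        (2 * π * 2 ^ j * Complex.I) * ((μ / 2 ^ j : ℝ) : ℂ) + π * Complex.I := by
      push_cast; field_simp
    rw [this, Complex.exp_add, hea, Complex.exp_pi_mul_I, one_mul]
  have hmain : (2:ℂ) ^ j * ((∫ y in (μ / 2 ^ j : ℝ)..((μ + 1/2) / 2 ^ j), e y) -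
      ∫ y in ((μ + 1/2) / 2 ^ j : ℝ)..((μ + 1) / 2 ^ j), e y) = ((2 / π : ℝ) : ℂ) * Complex.I := by
    rw [he, integral_exp_mul_complex hc, integral_exp_mul_complex hc, hea, heb, hem]
    have hpi : (π : ℂ) ≠ 0 := by exact_mod_cast Real.pi_ne_zero
    push_cast
    field_simp
    rw [Complex.I_sq]; ring
  have hA := hloc (μ / 2 ^ j) ((μ + 1/2) / 2 ^ j) (by positivity) (by gcongr; linarith)
    (by rw [div_le_one hpos]; linarith)
  have hB := hloc ((μ + 1/2) / 2 ^ j) ((μ + 1) / 2 ^ j) (by positivity) (by gcongr; linarith)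
    (by rw [div_le_one hpos]; linarith)
  rw [integral_mul_haarFn hwc]
  set a1 := ∫ y in (μ / 2 ^ j : ℝ)..((μ + 1/2) / 2 ^ j), wavePacket (2 ^ j) y
  set a2 := ∫ y in ((μ + 1/2) / 2 ^ j : ℝ)..((μ + 1) / 2 ^ j), wavePacket (2 ^ j) y
  set b1 := ∫ y in (μ / 2 ^ j : ℝ)..((μ + 1/2) / 2 ^ j), e y
  set b2 := ∫ y in ((μ + 1/2) / 2 ^ j : ℝ)..((μ + 1) / 2 ^ j), e y
  have h2n : ‖(2:ℂ) ^ j‖ = 2 ^ j := by simp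
  have herr : ‖(2:ℂ) ^ j * (b1 - b2) - 2 ^ j * (a1 - a2)‖ ≤ 1/10 := by
    have heq : (2:ℂ) ^ j * (b1 - b2) - 2 ^ j * (a1 - a2) =
        2 ^ j * ((a2 - b2) - (a1 - b1)) := by ring
    rw [heq, norm_mul, h2n]
    calc (2:ℝ) ^ j * ‖(a2 - b2) - (a1 - b1)‖
        ≤ 2 ^ j * (1/10 * ((μ + 1) / 2 ^ j - (μ + 1/2) / 2 ^ j) +
          1/10 * ((μ + 1/2) / 2 ^ j - μ / 2 ^ j)) := by
          gcongr
          exact (norm_sub_le _ _).trans (add_le_add hB hA)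
      _ = 1/10 := by field_simp; ring
  have hn : ‖(2:ℂ) ^ j * (b1 - b2)‖ = 2 / π := by
    rw [hmain, norm_mul, Complex.norm_I, mul_one, Complex.norm_real, Real.norm_eq_abs,
      abs_of_pos (by positivity)]
  have hπ : 6/10 ≤ 2 / π := by
    rw [le_div_iff₀ Real.pi_pos]; linarith [Real.pi_lt_d2]
  have := norm_sub_norm_le ((2:ℂ) ^ j * (b1 - b2)) (2 ^ j * (a1 - a2))
  linarith

/-- The primitive of the Littlewood-Paley kernel at unit scale. -/
def kernelPrimitive (φ₀ : ℝ → ℂ) (w : ℝ) : ℂ :=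
  ∫ u in Set.Iic w, 𝓕⁻ (fun ξ => φ₀ ξ - φ₀ (2*ξ)) u

theorem exists_schwartz_kernel {φ₀ : ℝ → ℂ} (hφsmooth : ContDiff ℝ (⊤ : ℕ∞) φ₀)
    (hφcpt : HasCompactSupport φ₀) (hφone : ∀ ξ : ℝ, |ξ| ≤ 4/3 → φ₀ ξ = 1)
    (hφzero : ∀ ξ : ℝ, 3/2 ≤ |ξ| → φ₀ ξ = 0) :
    ∃ G : SchwartzMap ℝ ℂ, 𝓕⁻ (fun ξ => φ₀ ξ - φ₀ (2*ξ)) = G ∧ G ≠ 0 := by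
  have hcp : HasCompactSupport fun ξ : ℝ => φ₀ ξ - φ₀ (2 * ξ) :=
    hφcpt.sub (by simpa using hφcpt.comp_smul (c := (2:ℝ)) two_ne_zero)
  set m : SchwartzMap ℝ ℂ := hcp.toSchwartzMap (by fun_prop) with hm
  have hmξ : ∀ ξ, m ξ = φ₀ ξ - φ₀ (2 * ξ) := fun ξ => rfl
  refine ⟨𝓕⁻ m, ?_, ?_⟩
  · rw [SchwartzMap.fourierInv_coe]; rfl
  · intro h
    have h1 : m = 0 := by
      rw [← FourierTransform.fourier_fourierInv_eq (F := SchwartzMap ℝ ℂ) m, h]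
      ext ξ
      simp
    have h2 := hmξ 1
    rw [h1, hφone 1 (by norm_num), hφzero (2 * 1) (by norm_num)] at h2
    simp at h2

theorem LPop_haarFn {φ₀ : ℝ → ℂ} {G : SchwartzMap ℝ ℂ}
    (hG : 𝓕⁻ (fun ξ => φ₀ ξ - φ₀ (2*ξ)) = G) (j : ℕ) {n : ℕ} (hn : n ≠ 0) (μ : ℤ) (x : ℝ) :
    LPop φ₀ (j + n) (haarFn j μ) x =
      kernelPrimitive φ₀ (2 ^ n * (2 ^ j * x - μ)) -
        2 * kernelPrimitive φ₀ (2 ^ n * (2 ^ j * x - μ - 1/2)) +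
        kernelPrimitive φ₀ (2 ^ n * (2 ^ j * x - μ - 1)) := by
  have hc : ∀ a b : ℝ, ∫ t in a..b, (2:ℂ) ^ (j + n) * G (2 ^ (j + n) * (x - t)) =
      kernelPrimitive φ₀ (2 ^ (j + n) * (x - a)) - kernelPrimitive φ₀ (2 ^ (j + n) * (x - b)) := by
    intro a b
    simp only [kernelPrimitive, hG]
    rw [intervalIntegral.integral_Iic_sub_Iic G.integrable.integrableOn G.integrable.integrableOn]
    have h := intervalIntegral.integral_comp_sub_mul (a := a) (b := b) (fun u => G u)
      (c := 2 ^ (j + n)) (by positivity) (2 ^ (j + n) * x)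
    simp only [mul_sub]
    rw [intervalIntegral.integral_const_mul, h, Complex.real_smul]
    push_cast
    rw [mul_inv_cancel_left₀ (pow_ne_zero _ two_ne_zero)]
  have hcont : Continuous fun t => (2:ℂ) ^ (j + n) * G (2 ^ (j + n) * (x - t)) := by
    have := G.continuous
    fun_prop
  simp only [LPop, show j + n ≠ 0 by omega, if_false, conv, hG]
  simp only [mul_comm (haarFn j μ _)]
  rw [integral_mul_haarFn hcont, hc, hc]
  have e1 : (2:ℝ) ^ (j + n) * (x - μ / 2 ^ j) = 2 ^ n * (2 ^ j * x - μ) := by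
    rw [pow_add]; field_simp
  have e2 : (2:ℝ) ^ (j + n) * (x - (μ + 1/2) / 2 ^ j) = 2 ^ n * (2 ^ j * x - μ - 1/2) := by
    rw [pow_add]; field_simp; ring
  have e3 : (2:ℝ) ^ (j + n) * (x - (μ + 1) / 2 ^ j) = 2 ^ n * (2 ^ j * x - μ - 1) := by
    rw [pow_add]; field_simp; ring
  rw [e1, e2, e3]
  ring

theorem hasDerivAt_kernelPrimitive {φ₀ : ℝ → ℂ} {G : SchwartzMap ℝ ℂ}
    (hG : 𝓕⁻ (fun ξ => φ₀ ξ - φ₀ (2*ξ)) = G) (w : ℝ) :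
    HasDerivAt (kernelPrimitive φ₀) (G w) w := by
  have h : kernelPrimitive φ₀ = fun w => (∫ u in (0:ℝ)..w, G u) + kernelPrimitive φ₀ 0 := by
    ext w
    simp only [kernelPrimitive, hG]
    rw [← intervalIntegral.integral_Iic_sub_Iic G.integrable.integrableOn
      G.integrable.integrableOn, sub_add_cancel]
  rw [h]
  exact (intervalIntegral.integral_hasDerivAt_right (G.continuous.intervalIntegrable _ _)
    G.continuous.stronglyMeasurable.stronglyMeasurableAtFilter
    G.continuous.continuousAt).add_const _

theorem tendsto_kernelPrimitive_atBot {φ₀ : ℝ → ℂ} {G : SchwartzMap ℝ ℂ}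
    (hG : 𝓕⁻ (fun ξ => φ₀ ξ - φ₀ (2*ξ)) = G) :
    Filter.Tendsto (kernelPrimitive φ₀) Filter.atBot (nhds 0) := by
  have h : kernelPrimitive φ₀ = fun w => kernelPrimitive φ₀ 0 - ∫ u in w..(0:ℝ), G u := by
    ext w
    simp only [kernelPrimitive, hG]
    rw [← intervalIntegral.integral_Iic_sub_Iic G.integrable.integrableOn
      G.integrable.integrableOn, sub_sub_cancel]
  have h2 := intervalIntegral_tendsto_integral_Iic (0:ℝ) (G.integrable (μ := volume)).integrableOn
    (Filter.tendsto_id (α := ℝ) (x := Filter.atBot))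
  have h3 : kernelPrimitive φ₀ 0 = ∫ u in Set.Iic (0:ℝ), G u := by
    simp only [kernelPrimitive, hG]
  rw [h]
  simpa [h3] using h2.const_sub (kernelPrimitive φ₀ 0)

theorem exists_le_norm_LPop_haarFn {φ₀ : ℝ → ℂ} (hφsmooth : ContDiff ℝ (⊤ : ℕ∞) φ₀)
    (hφcpt : HasCompactSupport φ₀) (hφone : ∀ ξ : ℝ, |ξ| ≤ 4/3 → φ₀ ξ = 1)
    (hφzero : ∀ ξ : ℝ, 3/2 ≤ |ξ| → φ₀ ξ = 0) :
    ∃ w ε δ : ℝ, 0 < ε ∧ 2 * ε < |w| ∧ 0 < δ ∧ ∃ n₀ : ℕ, ∀ n ≥ n₀, ∀ (j : ℕ) (μ : ℤ) (x : ℝ),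
      x ∈ jumpCell (2 ^ n)⁻¹ w ε j μ → δ ≤ ‖LPop φ₀ (j + n) (haarFn j μ) x‖ := by
  obtain ⟨G, hG, hG0⟩ := exists_schwartz_kernel hφsmooth hφcpt hφone hφzero
  have hd := hasDerivAt_kernelPrimitive hG
  have hcont : Continuous (kernelPrimitive φ₀) :=
    continuous_iff_continuousAt.2 fun w => (hd w).continuousAt
  have hne : ∃ w, kernelPrimitive φ₀ w ≠ 0 := by
    by_contra! h
    apply hG0
    ext w
    have h1 := hd w
    rw [show kernelPrimitive φ₀ = fun _ => 0 from funext h] at h1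
    exact h1.unique (hasDerivAt_const w 0)
  obtain ⟨w, hwmem, hw0⟩ : ∃ w, kernelPrimitive φ₀ w ≠ 0 ∧ w ≠ 0 := by
    obtain ⟨w, h1, h2⟩ := (dense_compl_singleton (0:ℝ)).exists_mem_open
      (isOpen_ne_fun hcont continuous_const) hne
    exact ⟨w, h2, h1⟩
  set a := ‖kernelPrimitive φ₀ w‖ with ha
  have ha0 : 0 < a := norm_pos_iff.2 hwmem
  obtain ⟨ρ, hρ, hclose⟩ := Metric.continuousAt_iff.1 hcont.continuousAt (a / 2) (by positivity)
  have hw' : 0 < |w| := abs_pos.2 hw0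
  obtain ⟨T, hT⟩ := Filter.eventually_atBot.1
    (Metric.tendsto_nhds.1 (tendsto_kernelPrimitive_atBot hG) (a / 16) (by positivity))
  set ε := min ρ (|w| / 4) with hε
  have hε0 : 0 < ε := lt_min hρ (by positivity)
  obtain ⟨n₀, hn₀⟩ := pow_unbounded_of_one_lt (2 * (w + ε - T)) (one_lt_two (α := ℝ))
  refine ⟨w, ε, a / 4, hε0, ?_, by positivity, n₀ + 1, fun n hn j μ x hx => ?_⟩
  · have := min_le_right ρ (|w| / 4)
    linarith
  · have h2n : (2:ℝ) ^ n₀ ≤ 2 ^ n := pow_le_pow_right₀ (by norm_num) (by omega)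
    have hpos : (0:ℝ) < 2 ^ n := by positivity
    obtain ⟨hx1, hx2⟩ := hx
    rw [inv_mul_le_iff₀ hpos] at hx1
    rw [lt_inv_mul_iff₀ hpos] at hx2
    rw [LPop_haarFn hG j (by omega) μ x]
    set y := 2 ^ j * x - (μ:ℝ)
    have k1 := hclose (x := 2 ^ n * y) (by
      rw [Real.dist_eq, abs_of_nonneg (by linarith)]
      have := min_le_left ρ (|w| / 4)
      linarith)
    have k2 := hT (2 ^ n * (y - 1/2)) (by nlinarith)
    have k3 := hT (2 ^ n * (y - 1)) (by nlinarith)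
    rw [dist_zero_right] at k2 k3
    rw [dist_eq_norm] at k1
    have e1 := norm_sub_norm_le (kernelPrimitive φ₀ w) (kernelPrimitive φ₀ (2 ^ n * y))
    rw [norm_sub_rev] at e1
    have e2 := norm_sub_norm_le (kernelPrimitive φ₀ (2 ^ n * y))
      (2 * kernelPrimitive φ₀ (2 ^ n * (y - 1/2)))
    have e3 := norm_sub_norm_le (kernelPrimitive φ₀ (2 ^ n * y) -
      2 * kernelPrimitive φ₀ (2 ^ n * (y - 1/2))) (-kernelPrimitive φ₀ (2 ^ n * (y - 1)))
    rw [norm_neg, sub_neg_eq_add] at e3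
    rw [norm_mul, Complex.norm_ofNat] at e2
    linarith

/-- The coefficient of `h_e` in the Haar expansion of the wave packet at frequency `2 ^ j`. -/
def packetCoeff (e : ℕ × ℤ) (j : ℕ) : ℂ :=
  (2:ℂ) ^ e.1 * ∫ y : ℝ, wavePacket (2 ^ j) y * haarFn e.1 e.2 y

theorem LPop_haarProj_packetSum {φ₀ : ℝ → ℂ} (hφsmooth : ContDiff ℝ (⊤ : ℕ∞) φ₀)
    (hφcpt : HasCompactSupport φ₀) (s : ℝ) (E : Finset (ℕ × ℤ)) (S : Finset ℕ) (k : ℕ) (x : ℝ) :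
    LPop φ₀ k (haarProj E (packetSum s S)) x = ∑ e ∈ E, ∑ j ∈ S,
      (((2:ℝ) ^ (-((j:ℝ) * s)) : ℝ) : ℂ) * packetCoeff e j * LPop φ₀ k (haarFn e.1 e.2) x := by
  have hintegral : ∀ (e : ℕ × ℤ) (j : ℕ),
      Integrable fun y => wavePacket (2 ^ j) y * haarFn e.1 e.2 y := fun e j =>
    (wavePacket (2 ^ j)).integrable.mul_bdd (c := 2)
      (measurable_haarFn e.1 e.2).aestronglyMeasurable
      (Filter.Eventually.of_forall (norm_haarFn_le e.1 e.2))
  have hcoef : ∀ e : ℕ × ℤ, (2:ℂ) ^ e.1 * (∫ y : ℝ, packetSum s S y * haarFn e.1 e.2 y) =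
      ∑ j ∈ S, (((2:ℝ) ^ (-((j:ℝ) * s)) : ℝ) : ℂ) * packetCoeff e j := by
    intro e
    simp only [packetSum_apply, Finset.sum_mul, mul_assoc]
    rw [integral_finsetSum _ fun j _ => (hintegral e j).const_mul _, Finset.mul_sum]
    refine Finset.sum_congr rfl fun j _ => ?_
    rw [integral_const_mul, packetCoeff]
    ring
  obtain ⟨M, hM, -⟩ := exists_symbol hφsmooth hφcpt k
  simp only [hM]
  have hfun : haarProj E (packetSum s S) = fun t => ∑ e ∈ E,
      (∑ j ∈ S, (((2:ℝ) ^ (-((j:ℝ) * s)) : ℝ) : ℂ) * packetCoeff e j) * haarFn e.1 e.2 t := by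
    ext t
    simp only [haarProj, hcoef]
  rw [hfun, conv_sum]
  · simp only [Finset.sum_mul]
  · intro e _
    exact SchwartzMap.integrable_mul_comp_sub _ (measurable_haarFn e.1 e.2).aestronglyMeasurable
      (norm_haarFn_le e.1 e.2) x

theorem measurable_LPop {φ₀ : ℝ → ℂ} (hφsmooth : ContDiff ℝ (⊤ : ℕ∞) φ₀)
    (hφcpt : HasCompactSupport φ₀) (k : ℕ) {g : ℝ → ℂ} (hg : Measurable g) :
    Measurable (LPop φ₀ k g) := by
  obtain ⟨M, hM, -⟩ := exists_symbol hφsmooth hφcpt k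
  rw [hM]
  have hK := (𝓕⁻ M : SchwartzMap ℝ ℂ).continuous.measurable
  have : StronglyMeasurable (Function.uncurry fun x t : ℝ =>
      g t * (𝓕⁻ M : SchwartzMap ℝ ℂ) (x - t)) :=
    ((hg.comp measurable_snd).mul (hK.comp (measurable_fst.sub measurable_snd))).stronglyMeasurable
  exact this.integral_prod_right.measurable

theorem measurable_haarProj (E : Finset (ℕ × ℤ)) (f : ℝ → ℂ) : Measurable (haarProj E f) :=
  Finset.measurable_fun_sum E fun e _ => (measurable_haarFn e.1 e.2).const_mul _

theorem exists_subset_le_of_le_sum_powerset {ι κ : Type*} (s : Finset ι) (t : Finset κ)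
    (J : Finset ι → Finset κ → ℝ≥0∞) (a b : ℝ≥0∞)
    (h : 2 ^ (s.card + t.card) * a ≤ b * ∑ S ∈ s.powerset, ∑ T ∈ t.powerset, J S T) :
    ∃ S ⊆ s, ∃ T ⊆ t, a ≤ b * J S T := by
  by_contra! hlt
  have hsum : ∑ x ∈ s.powerset ×ˢ t.powerset, b * J x.1 x.2 <
      ∑ _x ∈ s.powerset ×ˢ t.powerset, a := by
    refine ENNReal.sum_lt_sum_of_nonempty ⟨(∅, ∅), by simp⟩ fun x hx => ?_
    rw [Finset.mem_product, Finset.mem_powerset, Finset.mem_powerset] at hx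
    exact hlt x.1 hx.1 x.2 hx.2
  rw [← Finset.mul_sum, Finset.sum_product, Finset.sum_const, Finset.card_product,
    Finset.card_powerset, Finset.card_powerset, ← pow_add, nsmul_eq_mul] at hsum
  push_cast at hsum
  exact absurd h (not_le.2 hsum)

theorem enorm_mul_rpow_le_tsum (φ₀ : ℝ → ℂ) {p q : ℝ} (hp : 0 < p) (hq : 0 < q) (s : ℝ)
    (g : ℝ → ℂ) (k : ℕ) (x : ℝ) :
    ‖(((2:ℝ) ^ ((k:ℝ) * s) : ℝ) : ℂ) * LPop φ₀ k g x‖ₑ ^ p ≤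
      (∑' k : ℕ, ENNReal.ofReal ((2:ℝ)^((k:ℝ)*s*q)) *
        (ENNReal.ofReal ‖LPop φ₀ k g x‖)^q)^(p/q) := by
  have hpow : (0:ℝ) ≤ (2:ℝ) ^ ((k:ℝ) * s) := by positivity
  have hterm : ENNReal.ofReal ((2:ℝ)^((k:ℝ)*s*q)) * (ENNReal.ofReal ‖LPop φ₀ k g x‖)^q =
      ‖(((2:ℝ) ^ ((k:ℝ) * s) : ℝ) : ℂ) * LPop φ₀ k g x‖ₑ ^ q := by
    rw [enorm_mul, ENNReal.mul_rpow_of_nonneg _ _ hq.le, ofReal_norm,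
      Real.rpow_mul two_pos.le, ← ENNReal.ofReal_rpow_of_nonneg hpow hq.le,
      ← ofReal_norm (((2:ℝ) ^ ((k:ℝ) * s) : ℝ) : ℂ), Complex.norm_real, Real.norm_of_nonneg hpow]
  have h := ENNReal.rpow_le_rpow (ENNReal.le_tsum (f := fun k : ℕ =>
    ENNReal.ofReal ((2:ℝ)^((k:ℝ)*s*q)) * (ENNReal.ofReal ‖LPop φ₀ k g x‖)^q) k)
    (div_nonneg hp.le hq.le)
  simp only [hterm] at h
  rw [← ENNReal.rpow_mul, mul_div_cancel₀ _ hq.ne'] at h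
  exact h

/-- The Haar indices of frequency exponent in `A` supported in `[0, 1)`. -/
def unitHaarIndices (A : Finset ℕ) : Finset (ℕ × ℤ) :=
  A.biUnion fun j => (Finset.Ico (0:ℤ) (2 ^ j)).image (Prod.mk j)

theorem HFset_subset_of_subset_unitHaarIndices {A : Finset ℕ} {E : Finset (ℕ × ℤ)}
    (hE : E ⊆ unitHaarIndices A) : HFset E ⊆ A := by
  intro j hj
  obtain ⟨e, he, rfl⟩ := Finset.mem_image.1 hj
  obtain ⟨i, hi, h⟩ := Finset.mem_biUnion.1 (hE he)
  obtain ⟨μ, -, rfl⟩ := Finset.mem_image.1 h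
  exact hi

theorem exists_le_FNorm_haarProj_packetSum {φ₀ : ℝ → ℂ} (hφsmooth : ContDiff ℝ (⊤ : ℕ∞) φ₀)
    (hφcpt : HasCompactSupport φ₀) {p q : ℝ} (hp : 1 < p) (hq : 0 < q) (s : ℝ) (A : Finset ℕ)
    {w ε δ : ℝ} (hδ : 0 < δ) {n : ℕ}
    (h : ∀ (j : ℕ) (μ : ℤ) (x : ℝ), x ∈ jumpCell (2 ^ n)⁻¹ w ε j μ →
      δ ≤ ‖LPop φ₀ (j + n) (haarFn j μ) x‖) :
    ∃ E ⊆ unitHaarIndices A, ∃ S ⊆ A,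
      ENNReal.ofReal ((2:ℝ) ^ ((n:ℝ) * s) * δ / 2) *
        volume (⋃ j ∈ A, jumpSet (2 ^ n)⁻¹ w ε j) ^ (1/p) ≤
      4 * FNorm φ₀ p q s (haarProj E (packetSum s S)) := by
  have hp0 : 0 < p := by linarith
  set U := ⋃ j ∈ A, jumpSet (2 ^ n)⁻¹ w ε j
  set D := ENNReal.ofReal ((2:ℝ) ^ ((n:ℝ) * s) * δ / 2)
  let F : Finset (ℕ × ℤ) → Finset ℕ → ℝ → ℝ≥0∞ := fun E S x =>
    (∑' k : ℕ, ENNReal.ofReal ((2:ℝ)^((k:ℝ)*s*q)) *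
      (ENNReal.ofReal ‖LPop φ₀ k (haarProj E (packetSum s S)) x‖)^q)^(p/q)
  have hF : ∀ E S, Measurable (F E S) := fun E S =>
    (Measurable.tsum fun k =>
      ((measurable_LPop hφsmooth hφcpt k
        (measurable_haarProj E _)).norm.ennreal_ofReal.pow_const q).const_mul _).pow_const _
  have hU : MeasurableSet U :=
    Finset.measurableSet_biUnion _ fun j _ => measurableSet_jumpSet _ _ _ j
  have hpt : ∀ x ∈ U, (2:ℝ≥0∞) ^ ((unitHaarIndices A).card + A.card) * D ^ p ≤
      2 ^ (2 * p) * ∑ E ∈ (unitHaarIndices A).powerset, ∑ S ∈ A.powerset, F E S x := by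
    intro x hx
    simp only [U, jumpSet, Set.mem_iUnion] at hx
    obtain ⟨j, hj, μ, hμ, hx⟩ := hx
    have he : (j, μ) ∈ unitHaarIndices A :=
      Finset.mem_biUnion.2 ⟨j, hj, Finset.mem_image_of_mem _ hμ⟩
    rw [Finset.mem_Ico] at hμ
    let y : ℕ × ℤ → ℕ → ℂ := fun e i => (((2:ℝ) ^ (((j + n : ℕ):ℝ) * s) : ℝ) : ℂ) *
      ((((2:ℝ) ^ (-((i:ℝ) * s)) : ℝ) : ℂ) * packetCoeff e i * LPop φ₀ (j + n) (haarFn e.1 e.2) x)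
    have hy : D ≤ ‖y (j, μ) j‖ₑ := by
      rw [← ofReal_norm]
      refine ENNReal.ofReal_le_ofReal ?_
      have hcoeff := half_le_norm_haar_coeff j hμ.1 hμ.2
      have hL := h j μ x hx
      have hpow : (2:ℝ) ^ (((j + n : ℕ):ℝ) * s) * (2:ℝ) ^ (-((j:ℝ) * s)) =
          (2:ℝ) ^ ((n:ℝ) * s) := by
        rw [← Real.rpow_add two_pos]; congr 1; push_cast; ring
      have hnorm : ‖y (j, μ) j‖ = (2:ℝ) ^ ((n:ℝ) * s) *
          (‖packetCoeff (j, μ) j‖ * ‖LPop φ₀ (j + n) (haarFn j μ) x‖) := by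
        simp only [y, norm_mul, Complex.norm_real]
        rw [Real.norm_of_nonneg (by positivity), Real.norm_of_nonneg (by positivity), ← hpow]
        ring
      have hc : 1 / 2 ≤ ‖packetCoeff (j, μ) j‖ := hcoeff
      rw [hnorm, mul_div_assoc]
      gcongr
      calc δ / 2 = 1 / 2 * δ := by ring
        _ ≤ _ := by gcongr
    calc (2:ℝ≥0∞) ^ ((unitHaarIndices A).card + A.card) * D ^ p
        ≤ 2 ^ ((unitHaarIndices A).card + A.card) * ‖y (j, μ) j‖ₑ ^ p := by gcongr
      _ ≤ _ := enorm_rpow_le_sum_powerset_powerset _ _ y he hj hp.le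
      _ ≤ _ := by
        refine mul_le_mul_right (Finset.sum_le_sum fun E _ => Finset.sum_le_sum fun S _ => ?_) _
        have := enorm_mul_rpow_le_tsum φ₀ hp0 hq s (haarProj E (packetSum s S)) (j + n) x
        rwa [LPop_haarProj_packetSum hφsmooth hφcpt, Finset.mul_sum,
          Finset.sum_congr rfl fun e _ => Finset.mul_sum _ _ _] at this
  have hintegral : (2:ℝ≥0∞) ^ ((unitHaarIndices A).card + A.card) * (D ^ p * volume U) ≤
      2 ^ (2 * p) * ∑ E ∈ (unitHaarIndices A).powerset, ∑ S ∈ A.powerset, ∫⁻ x, F E S x := by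
    have hsum : Measurable fun x =>
        ∑ E ∈ (unitHaarIndices A).powerset, ∑ S ∈ A.powerset, F E S x :=
      Finset.measurable_fun_sum _ fun E _ => Finset.measurable_fun_sum _ fun S _ => hF E S
    calc (2:ℝ≥0∞) ^ ((unitHaarIndices A).card + A.card) * (D ^ p * volume U)
        = ∫⁻ _ in U, 2 ^ ((unitHaarIndices A).card + A.card) * D ^ p := by
          rw [setLIntegral_const, mul_assoc]
      _ ≤ ∫⁻ x in U, 2 ^ (2 * p) *
          ∑ E ∈ (unitHaarIndices A).powerset, ∑ S ∈ A.powerset, F E S x :=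
          setLIntegral_mono' hU hpt
      _ ≤ ∫⁻ x, 2 ^ (2 * p) *
          ∑ E ∈ (unitHaarIndices A).powerset, ∑ S ∈ A.powerset, F E S x :=
          setLIntegral_le_lintegral _ _
      _ = _ := by
          rw [lintegral_const_mul _ hsum, lintegral_finsetSum _ fun E _ =>
            Finset.measurable_fun_sum _ fun S _ => hF E S]
          simp only [lintegral_finsetSum _ fun S _ => hF _ S]
  obtain ⟨E, hE, S, hS, hES⟩ := exists_subset_le_of_le_sum_powerset _ _ _ _ _ hintegral
  refine ⟨E, hE, S, hS, ?_⟩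
  have hroot := ENNReal.rpow_le_rpow hES (one_div_pos.2 hp0).le
  rw [ENNReal.mul_rpow_of_nonneg _ _ (one_div_pos.2 hp0).le,
    ENNReal.mul_rpow_of_nonneg _ _ (one_div_pos.2 hp0).le, ← ENNReal.rpow_mul,
    ← ENNReal.rpow_mul, mul_one_div_cancel hp0.ne', ENNReal.rpow_one,
    mul_assoc, mul_one_div_cancel hp0.ne', mul_one] at hroot
  have h4 : (2:ℝ≥0∞) ^ (2:ℝ) = 4 := by
    rw [ENNReal.rpow_ofNat]; norm_num
  rw [h4] at hroot
  exact hroot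

theorem le_volume_biUnion_jumpSet_inv_two_pow {w ε : ℝ} (hε : 0 < ε) (hw : 2 * ε < |w|) {m : ℕ}
    (hwm : 12 * |w| ≤ 2 ^ m) {A : Finset ℕ} (hA : A.Nonempty) :
    ENNReal.ofReal (ε / (4 * 2 ^ m)) ≤
      volume (⋃ j ∈ A, jumpSet (2 ^ (Nat.log 2 A.card + 1 + m))⁻¹ w ε j) := by
  have hN0 : A.card ≠ 0 := hA.card_pos.ne'
  have hlt : (A.card : ℝ) ≤ 2 ^ (Nat.log 2 A.card + 1) := by
    exact_mod_cast (Nat.lt_pow_succ_log_self one_lt_two A.card).le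
  have hge : (2:ℝ) ^ (Nat.log 2 A.card + 1) ≤ 2 * A.card := by
    rw [pow_succ']
    exact_mod_cast Nat.mul_le_mul_left 2 (Nat.pow_log_le_self 2 hN0)
  have hone : (1:ℝ) ≤ 2 ^ (Nat.log 2 A.card + 1) := one_le_pow₀ one_le_two
  have hm : (0:ℝ) < 2 ^ m := by positivity
  refine le_trans (ENNReal.ofReal_le_ofReal ?_)
    (le_volume_biUnion_jumpSet (by positivity) hε hw ?_ A ?_)
  · rw [pow_add]
    generalize (2:ℝ) ^ (Nat.log 2 A.card + 1) = L at *
    generalize (2:ℝ) ^ m = M at *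
    rw [show (A.card:ℝ) * ((L * M)⁻¹ * ε) / 2 = A.card * ε / (2 * (L * M)) by
      field_simp, div_le_div_iff₀ (by positivity) (by positivity)]
    nlinarith [mul_le_mul_of_nonneg_left hge (mul_pos hε hm).le]
  · rw [pow_add, inv_mul_le_iff₀ (by positivity), mul_one]
    nlinarith
  · rw [pow_add, mul_right_comm, ← div_eq_mul_inv, div_le_one (by positivity)]
    gcongr

/-- Lower bound, $1<p<q<\infty$, $1/q<s<1/p$: for every finite nonempty
$A\subset\mathbb N$ there are $E$ with $\mathrm{HF}(E)\subseteq A$ and a nonzero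
Schwartz $f$ with $\|P_E f\|\ge c(\#A)^{s-1/q}\|f\|$. -/
theorem haar_projection_lower_bound_pq
    (p q s : ℝ) (hp : 1 < p) (hpq : p < q)
    (hs1 : 1/q < s) (hs2 : s < 1/p)
    (φ₀ : ℝ → ℂ) (hφsmooth : ContDiff ℝ (⊤ : ℕ∞) φ₀) (hφcpt : HasCompactSupport φ₀)
    (hφone : ∀ ξ : ℝ, |ξ| ≤ 4/3 → φ₀ ξ = 1)
    (hφzero : ∀ ξ : ℝ, 3/2 ≤ |ξ| → φ₀ ξ = 0) :
    ∃ c : ℝ, 0 < c ∧ ∀ (A : Finset ℕ), A.Nonempty →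
      ∃ E : Finset (ℕ × ℤ), HFset E ⊆ A ∧
      ∃ f : SchwartzMap ℝ ℂ, f ≠ 0 ∧
        ENNReal.ofReal (c * ((A.card : ℝ))^(s - 1/q)) * FNorm φ₀ p q s f ≤
          FNorm φ₀ p q s (haarProj E f) := by
  have hp0 : 0 < p := by linarith
  have hq0 : 0 < q := by linarith
  have hs0 : 0 < s := (one_div_pos.2 hq0).trans hs1
  obtain ⟨w, ε, δ, hε, hw, hδ, n₀, hn₀⟩ :=
    exists_le_norm_LPop_haarFn hφsmooth hφcpt hφone hφzero
  obtain ⟨m₀, hm₀⟩ := pow_unbounded_of_one_lt (12 * |w|) (one_lt_two (α := ℝ))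
  let m := max n₀ m₀
  have hwm : 12 * |w| ≤ 2 ^ m := hm₀.le.trans (pow_le_pow_right₀ one_le_two (le_max_right _ _))
  set I := (∫⁻ x : ℝ, ‖wavePacket 0 x‖ₑ ^ p) ^ (1/p)
  have hI : I ≠ ∞ :=
    (ENNReal.rpow_lt_top_of_nonneg (one_div_pos.2 hp0).le
      (lintegral_wavePacket_rpow_lt_top hp).ne).ne
  have hI0 : 0 ≤ I.toReal := ENNReal.toReal_nonneg
  set v := (ε / (4 * 2 ^ m)) ^ (1/p)
  have hv : 0 < v := by positivity
  refine ⟨δ * v / (8 * (I.toReal + 1)), by positivity, fun A hA => ?_⟩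
  have hN : (0:ℝ) < A.card := by exact_mod_cast hA.card_pos
  obtain ⟨E, hE, S, hS, hES⟩ := exists_le_FNorm_haarProj_packetSum hφsmooth hφcpt hp hq0 s A hδ
    (hn₀ (Nat.log 2 A.card + 1 + m) ((le_max_left n₀ m₀).trans (Nat.le_add_left _ _)))
  have hNs : (A.card:ℝ) ^ s ≤ (2:ℝ) ^ (((Nat.log 2 A.card + 1 + m : ℕ):ℝ) * s) := by
    rw [Real.rpow_mul two_pos.le, Real.rpow_natCast]
    refine Real.rpow_le_rpow hN.le ?_ hs0.le
    calc (A.card:ℝ) ≤ 2 ^ (Nat.log 2 A.card + 1) := by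
          exact_mod_cast (Nat.lt_pow_succ_log_self one_lt_two A.card).le
      _ ≤ _ := pow_le_pow_right₀ one_le_two (Nat.le_add_right _ _)
  have hlow : ENNReal.ofReal ((A.card:ℝ) ^ s * (δ * v) / 8) ≤
      FNorm φ₀ p q s (haarProj E (packetSum s S)) := by
    have h4 : ENNReal.ofReal ((A.card:ℝ) ^ s * (δ * v) / 8) * 4 =
        ENNReal.ofReal ((A.card:ℝ) ^ s * δ / 2) * ENNReal.ofReal v := by
      rw [← ENNReal.ofReal_mul (by positivity), ← ENNReal.ofReal_ofNat 4,
        ← ENNReal.ofReal_mul (by positivity)]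
      congr 1; ring
    rw [← ENNReal.mul_le_mul_iff_left (c := 4) (by norm_num) (by norm_num), h4, mul_comm _ 4]
    refine le_trans (mul_le_mul' (ENNReal.ofReal_le_ofReal (by gcongr)) ?_) hES
    rw [← ENNReal.ofReal_rpow_of_pos (by positivity)]
    exact ENNReal.rpow_le_rpow (le_volume_biUnion_jumpSet_inv_two_pow hε hw hwm hA)
      (one_div_pos.2 hp0).le
  refine ⟨E, HFset_subset_of_subset_unitHaarIndices hE, packetSum s S, fun h0 => ?_, ?_⟩
  · have hzero : FNorm φ₀ p q s (haarProj E (packetSum s S)) = 0 := by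
      have hproj : haarProj E (packetSum s S) = fun _ => 0 := by
        ext x; simp [haarProj, h0]
      have hL : ∀ k x, LPop φ₀ k (fun _ => 0) x = 0 := fun k x => by
        unfold LPop; split_ifs <;> simp [conv]
      simp [hproj, FNorm, hL, hp0, hq0]
    rw [hzero, nonpos_iff_eq_zero, ENNReal.ofReal_eq_zero] at hlow
    have : 0 < (A.card:ℝ) ^ s * (δ * v) / 8 := by positivity
    linarith
  · refine le_trans ?_ hlow
    rw [FNorm_packetSum hφsmooth hφcpt hφone hφzero hp hpq]
    have hcard : (S.card : ℝ≥0∞) ^ (1/q) ≤ ENNReal.ofReal ((A.card:ℝ) ^ (1/q)) := by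
      rw [← ENNReal.ofReal_rpow_of_pos hN, ENNReal.ofReal_natCast]
      exact ENNReal.rpow_le_rpow (by exact_mod_cast Finset.card_le_card hS)
        (one_div_pos.2 hq0).le
    calc _ ≤ ENNReal.ofReal (δ * v / (8 * (I.toReal + 1)) * (A.card:ℝ) ^ (s - 1/q)) *
          (ENNReal.ofReal ((A.card:ℝ) ^ (1/q)) * ENNReal.ofReal I.toReal) := by
          rw [ENNReal.ofReal_toReal hI]
          gcongr
      _ = ENNReal.ofReal (δ * v / (8 * (I.toReal + 1)) * (A.card:ℝ) ^ (s - 1/q) *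
          ((A.card:ℝ) ^ (1/q) * I.toReal)) := by
          rw [← ENNReal.ofReal_mul (by positivity), ← ENNReal.ofReal_mul (by positivity)]
      _ ≤ _ := by
          refine ENNReal.ofReal_le_ofReal ?_
          have hsplit : (A.card:ℝ) ^ s = (A.card:ℝ) ^ (s - 1/q) * (A.card:ℝ) ^ (1/q) := by
            rw [← Real.rpow_add hN, sub_add_cancel]
          have hratio : I.toReal / (I.toReal + 1) ≤ 1 := by
            rw [div_le_one (by positivity)]; linarith
          calc _ = (A.card:ℝ) ^ s * (δ * v) / 8 * (I.toReal / (I.toReal + 1)) := by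
                rw [hsplit]; field_simp
            _ ≤ _ := mul_le_of_le_one_right (by positivity) hratio
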